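/- Let t and t' be rooted trees with t ⊲ t' (t' covers t). Then |SG(t)| · m(t;t') = n(t;t') · |SG(t')|. -/

import Mathlib

attribute [local instance] Classical.propDecidable

inductive PlanarTree : Type where
  | node : List PlanarTree → PlanarTree

namespace PlanarTree

/-- Isomorphism of (planar representatives of) rooted trees: the lists of
principal branches match up, pairwise isomorphically, after a permutation. -/
inductive Iso : PlanarTree → PlanarTree → Prop where
  | node {l m l' : List PlanarTree} :
      List.Perm l m → List.Forall₂ Iso m l' → Iso (node l) (node l')

/-- Number of vertices. -/
def size : PlanarTree → ℕ
  | node l => 1 + (l.attach.map fun c => size c.1).sum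
decreasing_by simp only [PlanarTree.node.sizeOf_spec]; exact Nat.lt_of_lt_of_le (List.sizeOf_lt_of_mem c.2) (Nat.le_add_left _ _)

mutual
  /-- All trees obtained by attaching the root of `s` by a new edge to some vertex. -/
  def graftList (s : PlanarTree) : PlanarTree → List PlanarTree
    | node l => node (s :: l) :: (graftAux s l).map node
  def graftAux (s : PlanarTree) : List PlanarTree → List (List PlanarTree)
    | [] => []
    | a :: l => ((graftList s a).map (· :: l)) ++ (graftAux s l).map (a :: ·)
end

/-- All trees obtained by adding a new edge and terminal vertex at some vertex. -/
def growList (t : PlanarTree) : List PlanarTree := graftList (node []) t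

mutual
  /-- All trees obtained by deleting one (non-root) terminal vertex. -/
  def pruneList : PlanarTree → List PlanarTree
    | node l => (pruneAux l).map node
  def pruneAux : List PlanarTree → List (List PlanarTree)
    | [] => []
    | a :: l =>
        (match a with | node [] => [l] | _ => []) ++
        ((pruneList a).map (· :: l)) ++ (pruneAux l).map (a :: ·)
end

mutual
  /-- All pairs (cut-off subtree, remaining tree) obtained by cutting one edge. -/
  def cutPairs : PlanarTree → List (PlanarTree × PlanarTree)
    | node l => (cutAux l).map fun x => (x.1, node x.2)
  def cutAux : List PlanarTree → List (PlanarTree × List PlanarTree)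
    | [] => []
    | a :: l =>
        (a, l) :: (((cutPairs a).map fun x => (x.1, x.2 :: l)) ++
          (cutAux l).map fun x => (x.1, a :: x.2))
end

/-- The order of the symmetry group `SG(t)`: the product over all vertices `v`
of the number of permutations of the branches at `v` exchanging isomorphic branches. -/
noncomputable def sg : PlanarTree → ℕ
  | node l =>
      (l.attach.map fun c => sg c.1).prod *
        Nat.card {σ : Equiv.Perm (Fin l.length) // ∀ i, Iso (l.get (σ i)) (l.get i)}
decreasing_by simp only [PlanarTree.node.sizeOf_spec]; exact Nat.lt_of_lt_of_le (List.sizeOf_lt_of_mem c.2) (Nat.le_add_left _ _)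

/-- Vertices of a planar tree, encoded as paths of child-indices from the root. -/
inductive IsVertex : PlanarTree → List ℕ → Prop where
  | root (t : PlanarTree) : IsVertex t []
  | child {l : List PlanarTree} {i : ℕ} {c : PlanarTree} {p : List ℕ} :
      l[i]? = some c → IsVertex c p → IsVertex (node l) (i :: p)

def Vertex (t : PlanarTree) : Type := {p : List ℕ // IsVertex t p}

/-- `v` lies strictly below `w` in the tree order (i.e. `w` is a proper ancestor of `v`). -/
def StrictBelow {t : PlanarTree} (v w : Vertex t) : Prop := w.1 <+: v.1 ∧ w.1 ≠ v.1

/-- A labelling of `t`. -/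
def Labelling (t : PlanarTree) : Type :=
  {f : Vertex t ≃ Fin t.size // ∀ v w, StrictBelow v w → f w < f v}

/-- Equivalence of labellings: they differ by an automorphism of the rooted tree. -/
def labelEquiv {t : PlanarTree} (f g : Labelling t) : Prop :=
  ∃ φ : Equiv.Perm (Vertex t),
    (∀ v w, StrictBelow (φ v) (φ w) ↔ StrictBelow v w) ∧ ∀ v, f.1 (φ v) = g.1 v

end PlanarTree

/-- Rooted trees: isomorphism classes of planar rooted trees. -/
instance planarSetoid : Setoid PlanarTree := Relation.EqvGen.setoid PlanarTree.Iso

def RTree : Type := Quotient planarSetoid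

namespace RTree

def mk (p : PlanarTree) : RTree := ⟦p⟧

/-- A chosen planar representative. -/
noncomputable def rep (T : RTree) : PlanarTree := Quotient.out T

noncomputable def size (T : RTree) : ℕ := T.rep.size

/-- The order of the symmetry (automorphism) group of `T`. -/
noncomputable def sg (T : RTree) : ℕ := T.rep.sg

/-- The one-vertex tree. -/
def bullet : RTree := mk (PlanarTree.node [])

/-- `Covers T T'` means `T ⊲ T'`: `T` is obtained from `T'` by deleting one terminal vertex. -/
noncomputable def Covers (T T' : RTree) : Prop :=
  ∃ p ∈ T'.rep.pruneList, mk p = T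

/-- `n(T;T')`: the number of vertices of `T` to which a new edge can be added to obtain `T'`. -/
noncomputable def nCov (T T' : RTree) : ℕ :=
  T.rep.growList.countP fun p => decide (mk p = T')

/-- `m(T;T')`: the number of (terminal) edges of `T'` which when removed leave `T`. -/
noncomputable def mCov (T T' : RTree) : ℕ :=
  T'.rep.pruneList.countP fun p => decide (mk p = T)

/-- `n(T₁,T₂;T₃)`: the number of vertices of `T₂` such that attaching the root of `T₁`
there by a new edge yields `T₃`. -/
noncomputable def nTri (T₁ T₂ T₃ : RTree) : ℕ :=
  (PlanarTree.graftList T₁.rep T₂.rep).countP fun p => decide (mk p = T₃)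

/-- `m(T₁,T₂;T₃)`: the number of edges of `T₃` whose removal cuts off a subtree
isomorphic to `T₁` leaving `T₂` (the piece containing the root). -/
noncomputable def mTri (T₁ T₂ T₃ : RTree) : ℕ :=
  T₃.rep.cutPairs.countP fun x => decide (mk x.1 = T₁ ∧ mk x.2 = T₂)

end RTree

section Ops

variable (k : Type*) [Semiring k]

/-- The element `𝔑(T) = Σ_{T ⊲ T'} n(T;T')·T'` of `k{T}`. -/
noncomputable def growF (T : RTree) : RTree →₀ k :=
  (T.rep.growList.map fun p => Finsupp.single (RTree.mk p) (1 : k)).sum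

/-- The element `𝔓(T) = Σ_{T' ⊲ T} m(T';T)·T'` of `k{T}`. -/
noncomputable def pruneF (T : RTree) : RTree →₀ k :=
  (T.rep.pruneList.map fun p => Finsupp.single (RTree.mk p) (1 : k)).sum

/-- The growth operator `𝔑` on `k{T}`. -/
noncomputable def Grow : Module.End k (RTree →₀ k) :=
  Finsupp.linearCombination k (growF k)

/-- The pruning operator `𝔓` on `k{T}`. -/
noncomputable def Prune : Module.End k (RTree →₀ k) :=
  Finsupp.linearCombination k (pruneF k)

/-- The operator `𝔇` on `k{T}`, `𝔇(t) = |t|·t`. -/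
noncomputable def Diag : Module.End k (RTree →₀ k) :=
  Finsupp.linearCombination k fun T => (T.size : k) • Finsupp.single T 1

/-- The inner product on `k{T}` determined by `(t,t') = |SG(t)|·δ_{t,t'}`. -/
noncomputable def innerT (x y : RTree →₀ k) : k :=
  x.sum fun T c => c * y T * (T.sg : k)

/-- Generalized multiplicity `n(T;T')`: coefficient of `T'` in `𝔑^{|T'|-|T|}(T)`. -/
noncomputable def nGen (T T' : RTree) : k :=
  ((Grow k ^ (T'.size - T.size)) (Finsupp.single T 1)) T'

/-- Generalized multiplicity `m(T;T')`: coefficient of `T` in `𝔓^{|T'|-|T|}(T')`. -/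
noncomputable def mGen (T T' : RTree) : k :=
  ((Prune k ^ (T'.size - T.size)) (Finsupp.single T' 1)) T

end Ops

section Kreimer

variable (k : Type*) [CommSemiring k]

/-- Kreimer's Hopf algebra `H_K`, as a commutative algebra: the free polynomial
algebra on rooted trees. -/
abbrev HK := MvPolynomial RTree k

/-- The inclusion `k{T} → H_K` of the linear span of the variables. -/
noncomputable def toHK : (RTree →₀ k) →ₗ[k] HK k :=
  Finsupp.linearCombination k fun T => MvPolynomial.X T

/-- The growth derivation `N` on `H_K`, with `N(t) = 𝔑(t)` for rooted trees `t`. -/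
noncomputable def ND : Derivation k (HK k) (HK k) :=
  MvPolynomial.mkDerivation k fun T => toHK k (growF k T)

/-- The pruning derivation `P` on `H_K`, with `P(t) = 𝔓(t)` for `|t| ≥ 2`, `P(•) = 1`. -/
noncomputable def PD : Derivation k (HK k) (HK k) :=
  MvPolynomial.mkDerivation k fun T =>
    if T = RTree.bullet then 1 else toHK k (pruneF k T)

/-- The grading derivation `D` on `H_K`, multiplying each homogeneous element of
degree `n` by `n`; it is the derivation with `D(t) = |t|·t` for rooted trees `t`. -/
noncomputable def DD : Derivation k (HK k) (HK k) :=
  MvPolynomial.mkDerivation k fun T => (T.size : k) • MvPolynomial.X T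

/-- The map `B₊ : H_K → k{T}` sending a forest to the tree obtained by attaching
all its roots to a new root vertex. -/
noncomputable def forestTree (d : RTree →₀ ℕ) : RTree :=
  RTree.mk (PlanarTree.node
    (d.support.toList.flatMap fun T => List.replicate (d T) T.rep))

noncomputable def Bplus (p : HK k) : RTree →₀ k :=
  ∑ d ∈ p.support, Finsupp.single (forestTree d) (MvPolynomial.coeff d p)

/-- The inner product on `H_K`. -/
noncomputable def innerHK (u v : HK k) : k := innerT k (Bplus k u) (Bplus k v)

/-- The degree-`n` homogeneous component of `H_K`. -/
noncomputable abbrev HKcomp (n : ℕ) : Submodule k (HK k) :=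
  MvPolynomial.weightedHomogeneousSubmodule k (fun T : RTree => T.size) n

/-- `T_i`: the number of rooted trees with `i+1` vertices. -/
noncomputable def Tcard (i : ℕ) : ℕ := Nat.card {T : RTree // T.size = i + 1}

end Kreimer

namespace PlanarTree

open List in
theorem iso_node_iff {l l' : List PlanarTree} :
    Iso (node l) (node l') ↔ ∃ m, l ~ m ∧ Forall₂ Iso m l' :=
  ⟨fun h => by cases h with | node h₁ h₂ => exact ⟨_, h₁, h₂⟩, fun ⟨_, h₁, h₂⟩ => .node h₁ h₂⟩

theorem sizeOf_lt_node {l : List PlanarTree} {c : PlanarTree} (h : c ∈ l) :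
    sizeOf c < sizeOf (node l) := by
  rw [PlanarTree.node.sizeOf_spec]
  exact Nat.lt_of_lt_of_le (List.sizeOf_lt_of_mem h) (Nat.le_add_left _ _)

/-- Structural induction: a property inherited from the principal branches holds for all trees. -/
theorem branchInduction {P : PlanarTree → Prop}
    (node : ∀ l : List PlanarTree, (∀ c ∈ l, P c) → P (node l)) : ∀ p, P p
  | .node l => node l fun c hc =>
      have := sizeOf_lt_node hc
      branchInduction node c
termination_by p => sizeOf p

/-- `List.Forall₂` can be mapped along an implication which holds on the left-hand list. -/
theorem forall₂_imp_left {α β : Type*} {R S : α → β → Prop} {l : List α} {l' : List β}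
    (h : List.Forall₂ R l l') (H : ∀ a ∈ l, ∀ b, R a b → S a b) : List.Forall₂ S l l' := by
  induction h with
  | nil => exact .nil
  | cons hab _ ih =>
    exact .cons (H _ (by simp) _ hab) (ih fun a ha => H a (by simp [ha]))

/-- `List.Forall₂` is transitive if the relation is transitive starting from the left-hand list. -/
theorem forall₂_trans_left {α : Type*} {R : α → α → Prop} {l m n : List α}
    (h : List.Forall₂ R l m) (h' : List.Forall₂ R m n)
    (H : ∀ a ∈ l, ∀ b c, R a b → R b c → R a c) : List.Forall₂ R l n := by
  induction h generalizing n with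
  | nil => exact h'
  | cons hab _ ih =>
    obtain ⟨c, n', hbc, hmn, rfl⟩ := List.forall₂_cons_left_iff.1 h'
    exact .cons (H _ (by simp) _ _ hab hbc) (ih hmn fun a ha => H a (by simp [ha]))

theorem iso_refl (p : PlanarTree) : Iso p p := by
  induction p using branchInduction with
  | node l ih => exact .node (.refl l) (List.forall₂_same.2 ih)

theorem iso_symm {p q : PlanarTree} (h : Iso p q) : Iso q p := by
  induction p using branchInduction generalizing q with
  | node l ih =>
    obtain ⟨l'⟩ := q
    obtain ⟨m, hlm, hml⟩ := iso_node_iff.1 h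
    have hlm' : List.Forall₂ Iso l' m :=
      (forall₂_imp_left (S := fun a b => Iso b a) hml
        fun a ha b hab => ih a (hlm.mem_iff.2 ha) hab).flip
    have hc : Relation.Comp (List.Forall₂ Iso) List.Perm l' l := ⟨m, hlm', hlm.symm⟩
    rw [List.forall₂_comp_perm_eq_perm_comp_forall₂] at hc
    exact iso_node_iff.2 hc

theorem iso_trans {p q r : PlanarTree} (h : Iso p q) (h' : Iso q r) : Iso p r := by
  induction p using branchInduction generalizing q r with
  | node l ih =>
    obtain ⟨l'⟩ := q
    obtain ⟨l''⟩ := r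
    obtain ⟨m, hlm, hml⟩ := iso_node_iff.1 h
    obtain ⟨m', hlm', hml'⟩ := iso_node_iff.1 h'
    have hc : Relation.Comp (List.Forall₂ Iso) List.Perm m m' := ⟨l', hml, hlm'⟩
    rw [List.forall₂_comp_perm_eq_perm_comp_forall₂] at hc
    obtain ⟨n, hmn, hnm⟩ := hc
    refine iso_node_iff.2 ⟨n, hlm.trans hmn, ?_⟩
    exact forall₂_trans_left hnm hml' fun a ha b c =>
      ih a ((hlm.trans hmn).mem_iff.2 ha)

theorem mk_eq_mk_iff_iso {p q : PlanarTree} : RTree.mk p = RTree.mk q ↔ Iso p q := by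
  constructor
  · intro h
    have h' : Relation.EqvGen Iso p q := Quotient.exact h
    clear h
    induction h' with
    | rel _ _ h => exact h
    | refl x => exact iso_refl x
    | symm _ _ _ ih => exact iso_symm ih
    | trans _ _ _ _ _ ih₁ ih₂ => exact iso_trans ih₁ ih₂
  · intro h
    exact Quotient.sound (Relation.EqvGen.rel _ _ h)

/-- The multiset of isomorphism classes of a list of planar trees. -/
def forest (l : List PlanarTree) : Multiset RTree := (l : Multiset PlanarTree).map RTree.mk

@[simp] theorem forest_nil : forest [] = 0 := rfl

@[simp] theorem forest_cons (a : PlanarTree) (l : List PlanarTree) :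
    forest (a :: l) = RTree.mk a ::ₘ forest l := rfl

theorem mk_mem_forest {a : PlanarTree} {l : List PlanarTree} (h : a ∈ l) :
    RTree.mk a ∈ forest l :=
  Multiset.mem_map_of_mem _ h

theorem mk_node_eq_iff {l l' : List PlanarTree} :
    RTree.mk (node l) = RTree.mk (node l') ↔ forest l = forest l' := by
  rw [mk_eq_mk_iff_iso, iso_node_iff]
  simp only [forest, Multiset.map_coe, Multiset.coe_eq_coe]
  constructor
  · rintro ⟨m, hlm, hml⟩
    refine (hlm.map _).trans (List.Perm.of_eq ?_)
    rw [← List.forall₂_eq_eq_eq, List.forall₂_map_left_iff, List.forall₂_map_right_iff]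
    exact hml.imp fun a b => mk_eq_mk_iff_iso.2
  · intro h
    obtain ⟨m, hlm, hml⟩ := List.perm_comp_forall₂ (r := fun T q => T = RTree.mk q) h
      (List.forall₂_map_left_iff.2 (List.forall₂_same.2 fun _ _ => rfl))
    have hc : Relation.Comp (List.Forall₂ Iso) List.Perm l l' :=
      ⟨m, (List.forall₂_map_left_iff.1 hlm).imp fun a b => mk_eq_mk_iff_iso.1, hml⟩
    rwa [List.forall₂_comp_perm_eq_perm_comp_forall₂] at hc

theorem sg_node (l : List PlanarTree) :
    sg (node l) = (l.map sg).prod *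
      ∏ T ∈ (forest l).toFinset, ((forest l).count T).factorial := by
  rw [sg, List.attach_map_val (f := sg)]
  congr 1
  let f : Fin l.length → RTree := fun i => RTree.mk (l.get i)
  have hf : (Finset.univ : Finset (Fin l.length)).val.map f = forest l := by
    simp only [f, Fin.univ_val_map, forest, Multiset.map_coe, Multiset.coe_eq_coe]
    apply List.Perm.of_eq
    apply List.ext_get <;> simp
  have hcard := DomMulAct.stabilizer_card' f
  rw [← Nat.card_eq_fintype_card] at hcard
  rw [show (forest l).toFinset = Finset.univ.image f by rw [← hf]; rfl]
  trans Nat.card {g : Equiv.Perm (Fin l.length) // f ∘ g = f}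
  · refine Nat.card_congr (Equiv.subtypeEquivRight fun σ => ?_)
    simp only [funext_iff, Function.comp, f, mk_eq_mk_iff_iso]
  · rw [hcard]
    refine Finset.prod_congr rfl fun T _ => ?_
    rw [← hf, Multiset.count_map, Fintype.card_subtype]
    simp only [eq_comm (a := T)]
    rfl

theorem sg_eq_of_mk_eq {p q : PlanarTree} (h : RTree.mk p = RTree.mk q) : sg p = sg q := by
  induction p using branchInduction generalizing q with
  | node l ih =>
    obtain ⟨l'⟩ := q
    rw [sg_node, sg_node, mk_node_eq_iff.1 h]
    congr 1
    obtain ⟨m, hlm, hml⟩ := iso_node_iff.1 (mk_eq_mk_iff_iso.1 h)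
    rw [(hlm.map sg).prod_eq]
    congr 1
    rw [← List.forall₂_eq_eq_eq, List.forall₂_map_left_iff, List.forall₂_map_right_iff]
    exact forall₂_imp_left hml fun a ha b hab =>
      ih a (hlm.mem_iff.2 ha) (mk_eq_mk_iff_iso.2 hab)

theorem sg_mk (p : PlanarTree) : (RTree.mk p).sg = sg p :=
  sg_eq_of_mk_eq (Quotient.out_eq (RTree.mk p))

/-- The order of the symmetry group of a forest. -/
noncomputable def forestSg (A : Multiset RTree) : ℕ :=
  (A.map RTree.sg).prod * ∏ T ∈ A.toFinset, (A.count T).factorial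

theorem sg_node_eq_forestSg (l : List PlanarTree) : sg (node l) = forestSg (forest l) := by
  rw [sg_node, forestSg]
  congr 1
  simp [forest, Multiset.map_coe, Function.comp_def, sg_mk]

theorem forestSg_cons (a : RTree) (C : Multiset RTree) :
    forestSg (a ::ₘ C) = forestSg C * (a.sg * (a ::ₘ C).count a) := by
  have h₁ : ∏ T ∈ C.toFinset, (C.count T).factorial =
      ∏ T ∈ (a ::ₘ C).toFinset, (C.count T).factorial := by
    refine Finset.prod_subset (by simp) fun T _ hT => ?_
    rw [Multiset.mem_toFinset] at hT
    simp [Multiset.count_eq_zero_of_notMem hT]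
  have ha : a ∈ (a ::ₘ C).toFinset := by simp
  have h₂ : ∏ T ∈ (a ::ₘ C).toFinset, ((a ::ₘ C).count T).factorial =
      (a ::ₘ C).count a * ∏ T ∈ (a ::ₘ C).toFinset, (C.count T).factorial := by
    rw [← Finset.mul_prod_erase _ _ ha,
      ← Finset.mul_prod_erase _ (fun T => (C.count T).factorial) ha,
      Multiset.count_cons_self, Nat.factorial_succ, mul_assoc]
    congr 2
    refine Finset.prod_congr rfl fun T hT => ?_
    rw [Multiset.count_cons_of_ne (Finset.ne_of_mem_erase hT)]
  rw [forestSg, forestSg, h₁, h₂, Multiset.map_cons, Multiset.prod_cons]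
  ring

theorem sum_map_ite_zero {α : Type*} (s : Multiset α) (P : α → Prop) (K : ℕ) :
    (s.map fun a => if P a then K else 0).sum = s.countP P * K := by
  induction s using Multiset.induction_on with
  | empty => simp
  | cons a s ih =>
    rw [Multiset.map_cons, Multiset.sum_cons, ih, Multiset.countP_cons]
    split_ifs <;> ring

/-- Counting the ways to complete `C` to the forest of `l` by one of the trees in `X`, weighted by
the order of the symmetry group. -/
theorem forestSg_mul_countP (l : List PlanarTree) (C : Multiset RTree) (X : List PlanarTree) :
    forestSg (forest l) * X.countP (fun x => decide (RTree.mk x ::ₘ C = forest l)) =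
      ((l : Multiset PlanarTree).map fun a =>
        if (forest l).erase (RTree.mk a) = C then
          forestSg C * (sg a * X.countP fun x => decide (RTree.mk x = RTree.mk a)) else 0).sum := by
  by_cases h : ∃ α, forest l = α ::ₘ C
  · obtain ⟨α, hα⟩ := h
    have h₁ : ∀ a ∈ (l : Multiset PlanarTree),
        (if (forest l).erase (RTree.mk a) = C then
          forestSg C * (sg a * X.countP fun x => decide (RTree.mk x = RTree.mk a)) else 0) =
        if α = RTree.mk a then
          forestSg C * (α.sg * X.countP fun x => decide (RTree.mk x = α)) else 0 := by
      intro a ha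
      have hc := Multiset.cons_erase (mk_mem_forest (Multiset.mem_coe.1 ha))
      have : (forest l).erase (RTree.mk a) = C ↔ α = RTree.mk a := by
        constructor
        · intro h
          rw [h, hα] at hc
          exact ((Multiset.cons_inj_left C).1 hc).symm
        · intro h
          rw [hα, h, Multiset.erase_cons_head]
      by_cases h : α = RTree.mk a
      · rw [if_pos (this.2 h), if_pos h, h, sg_mk]
      · rw [if_neg (mt this.1 h), if_neg h]
    have h₂ : (forest l).count α = (l : Multiset PlanarTree).countP fun a => α = RTree.mk a := by
      rw [forest, Multiset.count_map, Multiset.countP_eq_card_filter]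
    rw [Multiset.map_congr rfl h₁, sum_map_ite_zero, ← h₂, hα, forestSg_cons]
    simp only [Multiset.cons_inj_left]
    ring
  · have h₁ : ∀ a ∈ (l : Multiset PlanarTree),
        (if (forest l).erase (RTree.mk a) = C then
          forestSg C * (sg a * X.countP fun x => decide (RTree.mk x = RTree.mk a)) else 0) = 0 := by
      refine fun a ha => if_neg fun hC => h ⟨RTree.mk a, ?_⟩
      rw [← hC, Multiset.cons_erase (mk_mem_forest (Multiset.mem_coe.1 ha))]
    have h₂ : X.countP (fun x => decide (RTree.mk x ::ₘ C = forest l)) = 0 :=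
      List.countP_eq_zero.2 fun x _ hx => h ⟨RTree.mk x, (of_decide_eq_true hx).symm⟩
    rw [Multiset.map_congr rfl h₁, h₂]
    simp

theorem erase_mk_cons_forest (T : RTree) {b : PlanarTree} {l : List PlanarTree} (hb : b ∈ l) :
    (T ::ₘ forest l).erase (RTree.mk b) = T ::ₘ (forest l).erase (RTree.mk b) := by
  obtain ⟨E, hE⟩ := Multiset.exists_cons_of_mem (mk_mem_forest hb)
  rw [hE, Multiset.cons_swap, Multiset.erase_cons_head, Multiset.erase_cons_head]

theorem pruneAux_cons (a : PlanarTree) (l : List PlanarTree) :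
    pruneAux (a :: l) = (if a = node [] then [l] else []) ++
      (pruneList a).map (· :: l) ++ (pruneAux l).map (a :: ·) := by
  obtain ⟨_ | ⟨b, m⟩⟩ := a <;> simp [pruneAux]

/-- The forests obtained from the branches `l` by deleting one terminal vertex. -/
theorem map_forest_pruneAux (l : List PlanarTree) :
    ((pruneAux l : Multiset (List PlanarTree)).map forest) =
      (l : Multiset PlanarTree).bind fun b =>
        (if b = node [] then {(forest l).erase (RTree.mk b)} else 0) +
          (pruneList b : Multiset PlanarTree).map
            fun x => RTree.mk x ::ₘ (forest l).erase (RTree.mk b) := by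
  induction l with
  | nil => simp [pruneAux]
  | cons a l ih =>
    have h₁ : (((pruneAux l).map (a :: ·) : List (List PlanarTree)) :
          Multiset (List PlanarTree)).map forest =
        ((pruneAux l : Multiset (List PlanarTree)).map forest).map (RTree.mk a ::ₘ ·) := by
      simp [Function.comp_def]
    rw [pruneAux_cons, ← Multiset.cons_coe, Multiset.cons_bind, ← Multiset.coe_add,
      ← Multiset.coe_add, Multiset.map_add, Multiset.map_add, h₁, ih, Multiset.map_bind,
      forest_cons, Multiset.erase_cons_head]
    congr 1
    · congr 1
      · split_ifs <;> simp
      · simp [Function.comp_def]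
    · refine Multiset.bind_congr fun b hb => ?_
      rw [erase_mk_cons_forest _ (Multiset.mem_coe.1 hb), Multiset.map_add, Multiset.map_map]
      congr 1
      · split_ifs <;> simp
      · exact Multiset.map_congr rfl fun x _ => Multiset.cons_swap (RTree.mk a) (RTree.mk x)
          ((forest l).erase (RTree.mk b))

/-- The forests obtained from the branches `l` by grafting `s` onto one vertex. -/
theorem map_forest_graftAux (s : PlanarTree) (l : List PlanarTree) :
    ((graftAux s l : Multiset (List PlanarTree)).map forest) =
      (l : Multiset PlanarTree).bind fun a =>
          (graftList s a : Multiset PlanarTree).map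
            fun x => RTree.mk x ::ₘ (forest l).erase (RTree.mk a) := by
  induction l with
  | nil => simp [graftAux]
  | cons a l ih =>
    have h₁ : (((graftAux s l).map (a :: ·) : List (List PlanarTree)) :
          Multiset (List PlanarTree)).map forest =
        ((graftAux s l : Multiset (List PlanarTree)).map forest).map (RTree.mk a ::ₘ ·) := by
      simp [Function.comp_def]
    rw [graftAux, ← Multiset.cons_coe, Multiset.cons_bind, ← Multiset.coe_add,
      Multiset.map_add, h₁, ih, Multiset.map_bind, forest_cons, Multiset.erase_cons_head]
    congr 1
    · simp [Function.comp_def]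
    · refine Multiset.bind_congr fun b hb => ?_
      rw [erase_mk_cons_forest _ (Multiset.mem_coe.1 hb), Multiset.map_map]
      exact Multiset.map_congr rfl fun x _ => Multiset.cons_swap (RTree.mk a) (RTree.mk x)
          ((forest l).erase (RTree.mk b))

theorem mk_eq_bullet_iff {b : PlanarTree} : RTree.mk (node []) = RTree.mk b ↔ b = node [] := by
  obtain ⟨l⟩ := b
  rw [mk_node_eq_iff, forest_nil, eq_comm, forest, Multiset.map_eq_zero, Multiset.coe_eq_zero,
    node.injEq]

theorem countP_map_node (L : List (List PlanarTree)) (l : List PlanarTree) :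
    (L.map node).countP (fun x => decide (RTree.mk x = RTree.mk (node l))) =
      ((L : Multiset (List PlanarTree)).map forest).count (forest l) := by
  rw [List.countP_map, Multiset.count_map, ← Multiset.countP_eq_card_filter, Multiset.coe_countP]
  refine List.countP_congr fun x _ => ?_
  simp only [Function.comp, mk_node_eq_iff, eq_comm]

theorem count_map_mk_cons (X : List PlanarTree) (C A : Multiset RTree) :
    ((X : Multiset PlanarTree).map fun x => RTree.mk x ::ₘ C).count A =
      X.countP fun x => decide (RTree.mk x ::ₘ C = A) := by
  rw [Multiset.count_map, ← Multiset.countP_eq_card_filter, Multiset.coe_countP]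
  simp only [eq_comm]

theorem countP_pruneList_node (l l' : List PlanarTree) :
    (pruneList (node l')).countP (fun x => decide (RTree.mk x = RTree.mk (node l))) =
      ((l' : Multiset PlanarTree).map fun b =>
        (if (forest l').erase (RTree.mk b) = forest l then if b = node [] then 1 else 0 else 0) +
          (pruneList b).countP
            fun x => decide (RTree.mk x ::ₘ (forest l').erase (RTree.mk b) = forest l)).sum := by
  rw [pruneList, countP_map_node, map_forest_pruneAux, Multiset.count_bind]
  congr 1
  refine Multiset.map_congr rfl fun b _ => ?_
  rw [Multiset.count_add, count_map_mk_cons]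
  congr 1
  by_cases hb : b = node [] <;> simp [hb, Multiset.count_singleton, eq_comm]

theorem countP_graftList_node (s : PlanarTree) (l l' : List PlanarTree) :
    (graftList s (node l)).countP (fun x => decide (RTree.mk x = RTree.mk (node l'))) =
      [s].countP (fun x => decide (RTree.mk x ::ₘ forest l = forest l')) +
      ((l : Multiset PlanarTree).map fun a =>
          (graftList s a).countP
            fun x => decide (RTree.mk x ::ₘ (forest l).erase (RTree.mk a) = forest l')).sum := by
  rw [graftList, List.countP_cons, countP_map_node, map_forest_graftAux, Multiset.count_bind,
    add_comm, mk_node_eq_iff, forest_cons]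
  simp only [count_map_mk_cons, List.countP_cons, List.countP_nil, zero_add]
  congr

theorem sg_bullet : sg (node []) = 1 := by
  simp [sg_node]

/-- The number of prunings of `q` isomorphic to `p` and the number of growths of `p` isomorphic
to `q` agree when weighted by the orders of the symmetry groups. -/
theorem sg_mul_countP_pruneList (p q : PlanarTree) :
    sg p * q.pruneList.countP (fun x => decide (RTree.mk x = RTree.mk p)) =
      p.growList.countP (fun x => decide (RTree.mk x = RTree.mk q)) * sg q := by
  induction q using branchInduction generalizing p with
  | node l' ih =>
    obtain ⟨l⟩ := p
    rw [growList, countP_pruneList_node, countP_graftList_node, sg_node_eq_forestSg,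
      sg_node_eq_forestSg, mul_comm _ (forestSg (forest l')), mul_add, forestSg_mul_countP,
      Multiset.sum_map_add, mul_add, ← Multiset.sum_map_mul_left, ← Multiset.sum_map_mul_left,
      ← Multiset.sum_map_mul_left]
    congr 1
    · congr 1
      refine Multiset.map_congr rfl fun b _ => ?_
      by_cases hb : b = node [] <;> simp [hb, mk_eq_bullet_iff, sg_bullet]
    · simp only [forestSg_mul_countP]
      rw [Multiset.sum_map_sum_map]
      congr 1
      refine Multiset.map_congr rfl fun a _ => ?_
      congr 1
      refine Multiset.map_congr rfl fun b hb => ?_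
      rw [ih b (Multiset.mem_coe.1 hb) a, growList]
      by_cases h : (forest l).erase (RTree.mk a) = (forest l').erase (RTree.mk b)
      · rw [if_pos h, if_pos h.symm, h, mul_comm (sg b)]
      · rw [if_neg h, if_neg (Ne.symm h)]

end PlanarTree

/-- If `t ⊲ t'`, then `|SG(t)|·m(t;t') = n(t;t')·|SG(t')|`. -/
theorem stmt0 (t t' : RTree) (h : RTree.Covers t t') :
    t.sg * RTree.mCov t t' = RTree.nCov t t' * t'.sg := by
  have := PlanarTree.sg_mul_countP_pruneList t.rep t'.rep
  rwa [show RTree.mk t.rep = t from Quotient.out_eq t,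
    show RTree.mk t'.rep = t' from Quotient.out_eq t'] at this
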